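/- arXiv:2207.11833 — 3 statements merged into one kernel-verified Lean document; each statement's English description precedes it below -/
import Mathlib

section
/- Let f : ℝⁿ → ℝ be convex and differentiable with L-Lipschitz continuous gradient (L > 0), all norms Euclidean. Then for all x, y ∈ ℝⁿ: f(x) ≤ f(y) + ⟨∇f(x), x − y⟩ − (1/(2L))‖∇f(x) − ∇f(y)‖². -/
open scoped RealInnerProductSpace

theorem aux_line {n : ℕ} (f : EuclideanSpace ℝ (Fin n) → ℝ)
    (g : EuclideanSpace ℝ (Fin n) → EuclideanSpace ℝ (Fin n))
    (hgrad : ∀ x, HasGradientAt f (g x) x) (x v : EuclideanSpace ℝ (Fin n)) (t : ℝ) :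
    HasDerivAt (fun s : ℝ => f (x + s • v)) ⟪g (x + t • v), v⟫ t := by
  have h1 : HasDerivAt (fun s : ℝ => x + s • v) v t := by
    simpa using ((hasDerivAt_id t).smul_const v).const_add x
  have h2 := (hgrad (x + t • v)).hasFDerivAt.comp_hasDerivAt t h1
  simpa [Function.comp_def] using h2

theorem aux_conv {n : ℕ} (f : EuclideanSpace ℝ (Fin n) → ℝ)
    (g : EuclideanSpace ℝ (Fin n) → EuclideanSpace ℝ (Fin n))
    (hconv : ConvexOn ℝ Set.univ f)
    (hgrad : ∀ x, HasGradientAt f (g x) x) (x v : EuclideanSpace ℝ (Fin n)) :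
    f x + ⟪g x, v⟫ ≤ f (x + v) := by
  have hc : ConvexOn ℝ Set.univ (fun s : ℝ => f (x + s • v)) := by
    refine ⟨convex_univ, fun a _ b _ p q hp hq hpq => ?_⟩
    have h := hconv.2 (Set.mem_univ (x + a • v)) (Set.mem_univ (x + b • v)) hp hq hpq
    have e : x + (p • a + q • b) • v = p • (x + a • v) + q • (x + b • v) := by
      have : x = (p + q) • x := by rw [hpq, one_smul]
      nth_rewrite 1 [this]
      simp only [smul_eq_mul]
      module
    simpa only [e] using h
  have h := hc.le_slope_of_hasDerivAt (Set.mem_univ 0) (Set.mem_univ 1) one_pos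
    (aux_line f g hgrad x v 0)
  simp [slope_def_field] at h
  linarith

theorem aux_desc {n : ℕ} (f : EuclideanSpace ℝ (Fin n) → ℝ)
    (g : EuclideanSpace ℝ (Fin n) → EuclideanSpace ℝ (Fin n)) (L : ℝ)
    (hgrad : ∀ x, HasGradientAt f (g x) x)
    (hlip : ∀ x y, ‖g x - g y‖ ≤ L * ‖x - y‖) (x v : EuclideanSpace ℝ (Fin n)) :
    f (x + v) ≤ f x + ⟪g x, v⟫ + L / 2 * ‖v‖ ^ 2 := by
  have hB : ∀ t : ℝ, HasDerivAt (fun s : ℝ => f x + s * ⟪g x, v⟫ + L / 2 * ‖v‖ ^ 2 * s ^ 2)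
      (⟪g x, v⟫ + L * ‖v‖ ^ 2 * t) t := by
    intro t
    have h := (((hasDerivAt_id t).mul_const ⟪g x, v⟫).const_add (f x)).add
      (((hasDerivAt_id t).pow 2).const_mul (L / 2 * ‖v‖ ^ 2))
    refine (h.congr_deriv ?_)
    simp
    ring
  have hl := aux_line f g hgrad x v
  have h := image_le_of_deriv_right_le_deriv_boundary (a := 0) (b := 1)
    (fun t _ => (hl t).continuousAt.continuousWithinAt)
    (fun t _ => (hl t).hasDerivWithinAt) (B := fun s : ℝ => f x + s * ⟪g x, v⟫ + L / 2 * ‖v‖ ^ 2 * s ^ 2)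
    (by simp) (fun t _ => (hB t).continuousAt.continuousWithinAt)
    (fun t _ => (hB t).hasDerivWithinAt) (fun t ht => by
      have h1 := real_inner_le_norm (g (x + t • v) - g x) v
      have h2 := hlip (x + t • v) x
      rw [add_sub_cancel_left, norm_smul, Real.norm_of_nonneg ht.1] at h2
      rw [inner_sub_left] at h1
      nlinarith [mul_le_mul_of_nonneg_right h2 (norm_nonneg v)])
    (Set.right_mem_Icc.2 zero_le_one)
  simpa using h



/-- For a convex differentiable `f : ℝⁿ → ℝ` with `L`-Lipschitz gradient
(`L > 0`), for all `x y`: `f x ≤ f y + ⟪∇f x, x - y⟫ - (1/(2L)) ‖∇f x - ∇f y‖²`. -/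
theorem stmt_0 {n : ℕ} (f : EuclideanSpace ℝ (Fin n) → ℝ)
    (g : EuclideanSpace ℝ (Fin n) → EuclideanSpace ℝ (Fin n)) (L : ℝ) (hL : 0 < L)
    (hconv : ConvexOn ℝ Set.univ f)
    (hgrad : ∀ x, HasGradientAt f (g x) x)
    (hlip : ∀ x y, ‖g x - g y‖ ≤ L * ‖x - y‖) :
    ∀ x y, f x ≤ f y + ⟪g x, x - y⟫ - (1 / (2 * L)) * ‖g x - g y‖ ^ 2 := by
  intro x y
  have h1 := aux_desc f g L hgrad hlip y (L⁻¹ • (g x - g y))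
  have h2 := aux_conv f g hconv hgrad x (y - x + L⁻¹ • (g x - g y))
  have e : x + (y - x + L⁻¹ • (g x - g y)) = y + L⁻¹ • (g x - g y) := by abel
  rw [e, inner_add_right, real_inner_smul_right] at h2
  rw [real_inner_smul_right, norm_smul, mul_pow, Real.norm_eq_abs, sq_abs] at h1
  have e2 : ⟪g x, x - y⟫ = -⟪g x, y - x⟫ := by rw [← inner_neg_right, neg_sub]
  have e3 : ‖g x - g y‖ ^ 2 = ⟪g x, g x - g y⟫ - ⟪g y, g x - g y⟫ := by
    rw [← inner_sub_left, real_inner_self_eq_norm_sq]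
  have e4 : L / 2 * (L⁻¹ ^ 2 * ‖g x - g y‖ ^ 2) = L⁻¹ / 2 * ‖g x - g y‖ ^ 2 := by
    field_simp
  have e5 : 1 / (2 * L) * ‖g x - g y‖ ^ 2 = L⁻¹ / 2 * ‖g x - g y‖ ^ 2 := by
    field_simp
  have e6 : L⁻¹ * ‖g x - g y‖ ^ 2 = L⁻¹ * ⟪g x, g x - g y⟫ - L⁻¹ * ⟪g y, g x - g y⟫ := by
    rw [e3]; ring
  rw [e5, e2]
  rw [e4] at h1
  linarith
end

section
/- (Unconstrained strong-growth corollary.) Let f : ℝⁿ → ℝ be L-smooth and μ-strongly convex with L > μ ≥ 0, y* a minimizer of f, φ(u) = (1/2)‖u‖² (so σ = 1), and λ ∈ (0, 1]. Run the algorithm of the main theorem with C = ℝⁿ: A_0 = 0, y_0 ∈ ℝⁿ, v_0 = 0; for k ≥ 1, α_k > 0 with L α_k²/A_k = λ(μ A_k + 1), A_k = A_{k-1} + α_k; x_k = [ (μ A_k + 1) A_{k-1} y_{k-1} + (μ A_{k-1} + 1) α_k v_{k-1} ] / [ μ(A_k − α_k)(A_k + α_k) + A_k ]; ∇̃f(x_k)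 = ∇f(x_k) + ξ_k; s_k = s_{k-1} − α_k ∇̃f(x_k) with s_0 = 0; v_k = ( s_k + μ Σ_{i=1}^k α_i x_i )/( μ A_k + 1 ); y_k = (A_{k-1}/A_k) y_{k-1} + (α_k/A_k) v_k. If, conditionally on the history up to and including x_k, E[ξ_k] = 0 and E[‖ξ_k‖²] ≤ ((1 − λ)/(1 + λ)) ‖∇f(x_k)‖² for all k ≥ 1, then E[f(y_k)] − f(y*) ≤ (1/2)‖y*‖²/A_k for every k ≥ 1. -/
open scoped RealInnerProductSpace
open Finset MeasureTheory

section Helpers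

lemma hp_lip {E : Type*} [NormedAddCommGroup E] [InnerProductSpace ℝ E]
    (f : E → ℝ) (g : E → E) (L μ : ℝ) (hμ : 0 ≤ μ) (hLμ : μ < L)
    (hsmooth : ∀ x y, f y ≤ f x + ⟪g x, y - x⟫ + L / 2 * ‖y - x‖ ^ 2)
    (hsc : ∀ x y, f y ≥ f x + ⟪g x, y - x⟫ + μ / 2 * ‖y - x‖ ^ 2) (x y : E) :
    ‖g x - g y‖ ≤ L * ‖x - y‖ := by
  have hL : 0 < L := lt_of_le_of_lt hμ hLμ
  have key : ∀ x y, f x + ⟪g x, y - x⟫ + 1 / (2 * L) * ‖g y - g x‖ ^ 2 ≤ f y := by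
    intro x y
    have h1 := hsmooth y (y - L⁻¹ • (g y - g x))
    have h2 := hsc x (y - L⁻¹ • (g y - g x))
    have h3 : 0 ≤ μ / 2 * ‖y - L⁻¹ • (g y - g x) - x‖ ^ 2 := by positivity
    have e1 : y - L⁻¹ • (g y - g x) - y = - (L⁻¹ • (g y - g x)) := by abel
    have e2 : y - L⁻¹ • (g y - g x) - x = (y - x) - (L⁻¹ • (g y - g x)) := by abel
    rw [e1, norm_neg, norm_smul, inner_neg_right, inner_smul_right] at h1
    have e3 : ⟪g x, y - L⁻¹ • (g y - g x) - x⟫ = ⟪g x, y - x⟫ - L⁻¹ * ⟪g x, g y - g x⟫ := by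
      rw [e2, inner_sub_right, inner_smul_right]
    rw [e3] at h2
    have e4 : ⟪g y, g y - g x⟫ - ⟪g x, g y - g x⟫ = ‖g y - g x‖ ^ 2 := by
      rw [← inner_sub_left, real_inner_self_eq_norm_sq]
    have e5 : L / 2 * (‖L⁻¹‖ * ‖g y - g x‖) ^ 2 = 1 / (2 * L) * ‖g y - g x‖ ^ 2 := by
      rw [Real.norm_of_nonneg (by positivity)]; field_simp
    have e6 : L⁻¹ * ⟪g y, g y - g x⟫ - L⁻¹ * ⟪g x, g y - g x⟫
        = 2 * (1 / (2 * L) * ‖g y - g x‖ ^ 2) := by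
      rw [← mul_sub, e4]; field_simp
    rw [e5] at h1
    linarith
  have k1 := key x y
  have k2 := key y x
  have e1 : ⟪g x, y - x⟫ + ⟪g y, x - y⟫ = - ⟪g x - g y, x - y⟫ := by
    rw [← neg_sub x y, inner_neg_right, inner_sub_left]; ring
  rw [norm_sub_rev (g y) (g x)] at k1
  have e2 := real_inner_le_norm (g x - g y) (x - y)
  have e3 : 2 * (1 / (2 * L) * ‖g x - g y‖ ^ 2) = ‖g x - g y‖ ^ 2 / L := by field_simp
  have e4 : ‖g x - g y‖ ^ 2 / L ≤ ‖g x - g y‖ * ‖x - y‖ := by linarith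
  rw [div_le_iff₀ hL] at e4
  rcases (norm_nonneg (g x - g y)).eq_or_lt with h | h
  · rw [← h]; positivity
  · nlinarith

lemma hp_step {E : Type*} [NormedAddCommGroup E] [InnerProductSpace ℝ E]
    (L μ lam A' a m M A fx fy fyp fs : ℝ) (hμ : 0 ≤ μ) (hA' : 0 ≤ A') (ha : 0 < a)
    (hm : m = μ * A' + 1) (hM : M = μ * A + 1) (hA : A = A' + a)
    (hL : L * a ^ 2 / A = lam * M)
    (x y yp v vp w G ξ us : E)
    (hw : M • w = m • vp + (a * μ) • x)
    (hv : v = w - (a / M) • (G + ξ))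
    (hy : y - x = (a / A) • (v - w))
    (hyp : A' • (yp - x) = a • (x - w))
    (h1 : fy ≤ fx + ⟪G, y - x⟫ + L / 2 * ‖y - x‖ ^ 2)
    (h2 : fyp ≥ fx + ⟪G, yp - x⟫)
    (h3 : fs ≥ fx + ⟪G, us - x⟫ + μ / 2 * ‖us - x‖ ^ 2) :
    M / 2 * ‖v - us‖ ^ 2 + A * (fy - fs) ≤ m / 2 * ‖vp - us‖ ^ 2 + A' * (fyp - fs)
      + a * ⟪us - w, ξ⟫ + a ^ 2 / (2 * M) * ((1 + lam) * ‖ξ‖ ^ 2 - (1 - lam) * ‖G‖ ^ 2)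
      + a ^ 2 / M * lam * ⟪G, ξ⟫ := by
  have hApos : 0 < A := by linarith
  have hMpos : 0 < M := by rw [hM]; positivity
  have hmpos : 0 < m := by rw [hm]; positivity
  have hMm : M = m + a * μ := by rw [hM, hm, hA]; ring
  -- quadratic combination
  have q1 : M / 2 * ‖w - us‖ ^ 2 ≤ m / 2 * ‖vp - us‖ ^ 2 + a * μ / 2 * ‖us - x‖ ^ 2 := by
    have e : M • (w - us) = m • (vp - us) + (a * μ) • (x - us) := by
      rw [smul_sub, hw, hMm]; module
    have e2 : M ^ 2 * ‖w - us‖ ^ 2 = ‖m • (vp - us) + (a * μ) • (x - us)‖ ^ 2 := by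
      rw [← e, norm_smul, Real.norm_of_nonneg hMpos.le]; ring
    rw [norm_add_sq_real, norm_smul, norm_smul, inner_smul_left, inner_smul_right,
      Real.norm_of_nonneg hmpos.le, Real.norm_of_nonneg (by positivity : 0 ≤ a * μ)] at e2
    simp only [conj_trivial] at e2
    have e3 : 2 * ⟪vp - us, x - us⟫ ≤ ‖vp - us‖ ^ 2 + ‖x - us‖ ^ 2 := by
      have := real_inner_le_norm (vp - us) (x - us)
      nlinarith [sq_nonneg (‖vp - us‖ - ‖x - us‖)]
    have hamu : 0 ≤ m * (a * μ) := by positivity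
    rw [norm_sub_rev us x]
    have e4 : M * (M * ‖w - us‖ ^ 2) ≤ M * (m * ‖vp - us‖ ^ 2 + a * μ * ‖x - us‖ ^ 2) := by
      have := mul_le_mul_of_nonneg_left e3 hamu
      have e5 : M * (m * ‖vp - us‖ ^ 2 + a * μ * ‖x - us‖ ^ 2)
        = m^2 * ‖vp - us‖ ^ 2 + (a*μ)^2 * ‖x - us‖ ^ 2 
          + m * (a * μ) * (‖vp - us‖ ^ 2 + ‖x - us‖ ^ 2) := by rw [hMm]; ring
      rw [e5]; nlinarith
    have := le_of_mul_le_mul_left e4 hMpos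
    linarith
  -- expansion of v
  have q2 : M / 2 * ‖v - us‖ ^ 2 = M / 2 * ‖w - us‖ ^ 2 - a * ⟪w - us, G⟫ - a * ⟪w - us, ξ⟫
      + a ^ 2 / (2 * M) * (‖G‖ ^ 2 + 2 * ⟪G, ξ⟫ + ‖ξ‖ ^ 2) := by
    have e : v - us = (w - us) - (a / M) • (G + ξ) := by rw [hv]; abel
    rw [e, norm_sub_sq_real, inner_smul_right, inner_add_right, norm_smul,
      Real.norm_of_nonneg (by positivity : 0 ≤ a / M), mul_pow, norm_add_sq_real]
    field_simp
    ring
  have q3 : A * fy ≤ A * fx - a ^ 2 / M * (‖G‖ ^ 2 + ⟪G, ξ⟫)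
      + lam * (a ^ 2 / (2 * M)) * (‖G‖ ^ 2 + 2 * ⟪G, ξ⟫ + ‖ξ‖ ^ 2) := by
    have e : y - x = (-(a / A * (a / M))) • (G + ξ) := by rw [hy, hv]; module
    rw [e, inner_smul_right, inner_add_right, norm_smul, norm_neg,
      Real.norm_of_nonneg (by positivity : 0 ≤ a / A * (a / M)), mul_pow, norm_add_sq_real,
      real_inner_self_eq_norm_sq] at h1
    have e2 := mul_le_mul_of_nonneg_left h1 hApos.le
    refine e2.trans (le_of_eq ?_)
    have hLe : L * a ^ 2 = lam * M * A := by
      rw [div_eq_iff hApos.ne'] at hL; exact hL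
    have e3 : A * (L / 2 * ((a / A * (a / M)) ^ 2 * (‖G‖ ^ 2 + 2 * ⟪G, ξ⟫ + ‖ξ‖ ^ 2)))
        = (L * a ^ 2) * (a ^ 2 / (2 * A * M ^ 2)) * (‖G‖ ^ 2 + 2 * ⟪G, ξ⟫ + ‖ξ‖ ^ 2) := by
      field_simp
    rw [mul_add, e3, hLe]
    field_simp
    ring
  have q4 : A' * fx ≤ A' * fyp + a * ⟪G, w - x⟫ := by
    have e := mul_le_mul_of_nonneg_left h2 hA'
    have e2 : A' * ⟪G, yp - x⟫ = - (a * ⟪G, w - x⟫) := by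
      rw [← inner_smul_right, hyp, inner_smul_right, ← neg_sub w x, inner_neg_right]; ring
    linarith
  have q5 := mul_le_mul_of_nonneg_left h3 ha.le
  have e1 : ⟪us - w, ξ⟫ = - ⟪w - us, ξ⟫ := by rw [← neg_sub w us, inner_neg_left]
  have e2 : ⟪w - us, G⟫ = ⟪G, w - x⟫ - ⟪G, us - x⟫ := by
    rw [← inner_sub_right, real_inner_comm]; congr 1; abel
  rw [e1, q2, e2]
  have e3 : A * fx = A' * fx + a * fx := by rw [hA]; ring
  have e4 : A * (fy - fs) = A * fy - A' * fs - a * fs := by rw [hA]; ring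
  have e5 : a ^ 2 / M = 2 * (a ^ 2 / (2 * M)) := by field_simp
  rw [e4]
  rw [e5] at q3 ⊢
  generalize a ^ 2 / (2 * M) = c at *
  linarith

lemma hp_inner_int {Ω : Type*} [MeasurableSpace Ω] {E : Type*} [NormedAddCommGroup E] [InnerProductSpace ℝ E]
    (P : Measure Ω) {X Y : Ω → E} (hX : MemLp X 2 P) (hY : MemLp Y 2 P) :
    Integrable (fun ω => ⟪X ω, Y ω⟫) P := by
  have h1 := (memLp_two_iff_integrable_sq_norm hX.1).1 hX
  have h2 := (memLp_two_iff_integrable_sq_norm hY.1).1 hY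
  refine (h1.add h2).mono' (hX.1.inner hY.1) (Filter.Eventually.of_forall fun ω => ?_)
  have := norm_inner_le_norm (𝕜 := ℝ) (X ω) (Y ω)
  simp only [Pi.add_apply]
  nlinarith [sq_nonneg (‖X ω‖ - ‖Y ω‖), sq_nonneg (‖X ω‖), sq_nonneg (‖Y ω‖)]

lemma hp_inner_zero {Ω : Type*} {E : Type*} [NormedAddCommGroup E] [InnerProductSpace ℝ E]
    [CompleteSpace E] (m : MeasurableSpace Ω) [m0 : MeasurableSpace Ω]
    (P : Measure Ω) [IsProbabilityMeasure P] (hm : m ≤ m0) {X Y : Ω → E}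
    (hX : MemLp X 2 P) (hY : MemLp Y 2 P) (hXm : StronglyMeasurable[m] X)
    (h0 : P[Y|m] =ᵐ[P] 0) : ∫ ω, ⟪X ω, Y ω⟫ ∂P = 0 := by
  have h : P[fun ω => ⟪X ω, Y ω⟫|m] =ᵐ[P] fun ω => ⟪X ω, (P[Y|m]) ω⟫ :=
    condExp_bilin_of_stronglyMeasurable_left (innerSL ℝ (E := E)) hXm
      (hp_inner_int P hX hY) (hY.integrable (by norm_num))
  rw [← integral_condExp hm]
  rw [integral_congr_ae h]
  have : (fun ω => ⟪X ω, (P[Y|m]) ω⟫) =ᵐ[P] fun _ => (0 : ℝ) := by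
    filter_upwards [h0] with ω hω
    rw [hω]; simp
  rw [integral_congr_ae this]; simp

end Helpers

/-- Unconstrained strong-growth corollary: the algorithm of the main
theorem with `C = ℝⁿ`, `φ = (1/2)‖·‖²` (`σ = 1`), explicit dual-averaging update
`v_k = (s_k + μ Σ α_i x_i)/(μ A_k + 1)`, under the strong-growth noise condition
`E[‖ξ_k‖² | history] ≤ ((1-λ)/(1+λ))‖∇f(x_k)‖²`, satisfies
`E[f(y_k)] - f(y*) ≤ (1/2)‖y*‖²/A_k`. -/
theorem stmt_13 {n : ℕ} (f : EuclideanSpace ℝ (Fin n) → ℝ)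
    (g : EuclideanSpace ℝ (Fin n) → EuclideanSpace ℝ (Fin n))
    (L μ lam : ℝ) (hμ : 0 ≤ μ) (hLμ : μ < L) (hlam0 : 0 < lam) (hlam1 : lam ≤ 1)
    (hsmooth : ∀ x y, f y ≤ f x + ⟪g x, y - x⟫ + L / 2 * ‖y - x‖ ^ 2)
    (hsc : ∀ x y, f y ≥ f x + ⟪g x, y - x⟫ + μ / 2 * ‖y - x‖ ^ 2)
    (ystar : EuclideanSpace ℝ (Fin n)) (hmin : ∀ u, f ystar ≤ f u)
    -- probability space and filtration
    {Ω : Type*} [MeasurableSpace Ω] (P : Measure Ω) [IsProbabilityMeasure P]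
    (ℱ : ℕ → MeasurableSpace Ω) (hℱle : ∀ k, ℱ k ≤ ‹MeasurableSpace Ω›)
    (hℱmono : Monotone ℱ)
    -- the algorithm
    (α A : ℕ → ℝ) (x v y ξ s : ℕ → Ω → EuclideanSpace ℝ (Fin n))
    (hA0 : A 0 = 0)
    (hv0 : ∀ ω, v 0 ω = 0)
    (hs0 : ∀ ω, s 0 ω = 0)
    (hαpos : ∀ k, 1 ≤ k → 0 < α k)
    (hArec : ∀ k, 1 ≤ k → A k = A (k - 1) + α k)
    (hstep : ∀ k, 1 ≤ k → L * (α k) ^ 2 / A k = lam * (μ * A k + 1))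
    (hx : ∀ k, 1 ≤ k → ∀ ω, x k ω =
      (μ * (A k - α k) * (A k + α k) + A k)⁻¹ •
        (((μ * A k + 1) * A (k - 1)) • y (k - 1) ω
          + ((μ * A (k - 1) + 1) * α k) • v (k - 1) ω))
    (hx0 : x 0 = x 1)
    (hsrec : ∀ k, 1 ≤ k → ∀ ω, s k ω = s (k - 1) ω - α k • (g (x k ω) + ξ k ω))
    (hv : ∀ k, 1 ≤ k → ∀ ω, v k ω =
      (μ * A k + 1)⁻¹ • (s k ω + ∑ i ∈ Icc 1 k, (μ * α i) • x i ω))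
    (hy : ∀ k, 1 ≤ k → ∀ ω,
      y k ω = (A (k - 1) / A k) • y (k - 1) ω + (α k / A k) • v k ω)
    -- adaptedness, integrability and the conditional noise conditions
    (hxadapt : ∀ k, StronglyMeasurable[ℱ k] (x k))
    (hξadapt : ∀ k, StronglyMeasurable[ℱ (k + 1)] (ξ k))
    (hξint : ∀ k, Integrable (ξ k) P)
    (hξsqint : ∀ k, Integrable (fun ω => ‖ξ k ω‖ ^ 2) P)
    (hfyint : ∀ k, Integrable (fun ω => f (y k ω)) P)
    (hcond0 : ∀ k, 1 ≤ k → P[ξ k|ℱ k] =ᵐ[P] 0)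
    (hcondvar : ∀ k, 1 ≤ k → ∀ᵐ ω ∂P,
      (P[(fun ω => ‖ξ k ω‖ ^ 2)|ℱ k]) ω ≤
        (1 - lam) / (1 + lam) * ‖g (x k ω)‖ ^ 2) :
    ∀ k, 1 ≤ k → (∫ ω, f (y k ω) ∂P) - f ystar ≤ (1 / 2 * ‖ystar‖ ^ 2) / A k := by
  have hL0 : 0 < L := lt_of_le_of_lt hμ hLμ
  have hlip := hp_lip f g L μ hμ hLμ hsmooth hsc
  have hgc : Continuous g :=
    (LipschitzWith.of_dist_le_mul (K := ⟨L, hL0.le⟩) (fun a b => by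
      rw [dist_eq_norm, dist_eq_norm]; exact hlip a b)).continuous
  have hAr : ∀ k, A (k + 1) = A k + α (k + 1) := fun k => by
    simpa using hArec (k + 1) (by omega)
  have hαp : ∀ k, 0 < α (k + 1) := fun k => hαpos (k + 1) (by omega)
  have hA : ∀ k, 0 ≤ A k := by
    intro k
    induction k with
    | zero => exact hA0.ge
    | succ k ih => rw [hAr]; linarith [hαp k]
  have hA1 : ∀ k, 0 < A (k + 1) := fun k => by rw [hAr]; linarith [hαp k, hA k]
  have hM : ∀ k, 0 < μ * A k + 1 := fun k => by have := hA k; positivity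
  -- v for all k
  have hvM : ∀ k ω, (μ * A k + 1) • v k ω = s k ω + ∑ i ∈ Icc 1 k, (μ * α i) • x i ω := by
    intro k ω
    rcases Nat.eq_zero_or_pos k with rfl | hk
    · simp [hv0, hs0]
    · rw [hv k hk, smul_inv_smul₀ (hM k).ne']
  have hvrec : ∀ k ω, (μ * A (k + 1) + 1) • v (k + 1) ω = (μ * A k + 1) • v k ω
      + (α (k + 1) * μ) • x (k + 1) ω
      - α (k + 1) • (g (x (k + 1) ω) + ξ (k + 1) ω) := by
    intro k ω
    have h := hsrec (k + 1) (by omega) ω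
    simp only [Nat.add_sub_cancel] at h
    rw [hvM, hvM, Finset.sum_Icc_succ_top (by omega), h, mul_comm μ (α (k + 1))]
    abel
  -- the auxiliary point w
  obtain ⟨w, hwd⟩ : ∃ w : ℕ → Ω → EuclideanSpace ℝ (Fin n), ∀ k ω, w k ω =
    (μ * A (k + 1) + 1)⁻¹ • ((μ * A k + 1) • v k ω + (α (k + 1) * μ) • x (k + 1) ω) :=
    ⟨_, fun _ _ => rfl⟩
  have hcs : ∀ (c : ℝ) (X : Ω → EuclideanSpace ℝ (Fin n)), MemLp X 2 P →
      MemLp (fun ω => c • X ω) 2 P := fun c X hX => hX.const_smul c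
  have hms : ∀ (m : MeasurableSpace Ω) (c : ℝ) (X : Ω → EuclideanSpace ℝ (Fin n)),
      StronglyMeasurable[m] X → StronglyMeasurable[m] (fun ω => c • X ω) :=
    fun m c X hX => hX.const_smul c
  have hwM : ∀ k ω, (μ * A (k + 1) + 1) • w k ω
      = (μ * A k + 1) • v k ω + (α (k + 1) * μ) • x (k + 1) ω := fun k ω => by
    rw [hwd, smul_inv_smul₀ (hM (k + 1)).ne']
  have hvw : ∀ k ω, v (k + 1) ω = w k ω
      - (α (k + 1) / (μ * A (k + 1) + 1)) • (g (x (k + 1) ω) + ξ (k + 1) ω) := by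
    intro k ω
    have h := hvrec k ω
    rw [← hwM] at h
    have hne := (hM (k + 1)).ne'
    apply smul_right_injective _ hne
    simp only
    rw [h, smul_sub, smul_smul, mul_div_cancel₀ _ hne]
  have hyA : ∀ k ω, A (k + 1) • y (k + 1) ω = A k • y k ω + α (k + 1) • v (k + 1) ω := by
    intro k ω
    have hne := (hA1 k).ne'
    rw [hy (k + 1) (by omega), smul_add, smul_smul, smul_smul, mul_div_cancel₀ _ hne,
      mul_div_cancel₀ _ hne, Nat.add_sub_cancel]
  have hDpos : ∀ k, 0 < μ * (A (k + 1) - α (k + 1)) * (A (k + 1) + α (k + 1)) + A (k + 1) := by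
    intro k
    have h1 := hA k
    have h2 := hαp k
    have h3 := hA1 k
    have : A (k + 1) - α (k + 1) = A k := by rw [hAr]; ring
    rw [this]; positivity
  have hxk : ∀ k ω, x (k + 1) ω =
      (μ * (A (k + 1) - α (k + 1)) * (A (k + 1) + α (k + 1)) + A (k + 1))⁻¹ •
        ((μ * A (k + 1) + 1) • (A k • y k ω)
          + ((μ * A k + 1) * α (k + 1)) • v k ω) := by
    intro k ω
    have h := hx (k + 1) (by omega) ω
    simp only [Nat.add_sub_cancel] at h
    rw [h, smul_smul (μ * A (k + 1) + 1)]
  have hxw : ∀ k ω, A (k + 1) • x (k + 1) ω = A k • y k ω + α (k + 1) • w k ω := by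
    intro k ω
    have h := hxk k ω
    rw [eq_inv_smul_iff₀ (hDpos k).ne'] at h
    have hne := (hM (k + 1)).ne'
    apply smul_right_injective _ hne
    simp only
    rw [smul_add, smul_comm _ (α (k + 1)) (w k ω), hwM]
    have e : (μ * A (k + 1) + 1) • A (k + 1) • x (k + 1) ω
      = (μ * (A (k + 1) - α (k + 1)) * (A (k + 1) + α (k + 1)) + A (k + 1)) • x (k + 1) ω
        + (α (k + 1) * (α (k + 1) * μ)) • x (k + 1) ω := by module
    rw [e, h]; module
  -- L2 properties
  have hξL : ∀ k, MemLp (ξ k) 2 P := fun k =>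
    (memLp_two_iff_integrable_sq_norm (hξint k).1).2 (hξsqint k)
  have hgL : ∀ X : Ω → EuclideanSpace ℝ (Fin n), MemLp X 2 P →
      MemLp (fun ω => g (X ω)) 2 P := by
    intro X hX
    have h1 : MemLp (fun ω => g (X ω) - g 0) 2 P := by
      refine hX.of_le_mul (c := L) ?_ (Filter.Eventually.of_forall fun ω => ?_)
      · exact (hgc.comp_aestronglyMeasurable hX.1).sub aestronglyMeasurable_const
      · simpa using hlip (X ω) 0
    have h2 := h1.add (memLp_const (g 0))
    refine h2.ae_eq (Filter.Eventually.of_forall fun ω => ?_)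
    simp
  have hxL' : ∀ k, MemLp (v k) 2 P → MemLp (fun ω => A k • y k ω) 2 P →
      MemLp (x (k + 1)) 2 P := by
    intro k h1 h2
    rw [show x (k + 1) = _ from funext (hxk k)]
    exact hcs _ _ ((hcs _ _ h2).add (hcs _ _ h1))
  have hwL' : ∀ k, MemLp (v k) 2 P → MemLp (x (k + 1)) 2 P → MemLp (w k) 2 P := by
    intro k h1 h2
    rw [show w k = _ from funext (hwd k)]
    exact hcs _ _ ((hcs _ _ h1).add (hcs _ _ h2))
  have hvyL : ∀ k, MemLp (v k) 2 P ∧ MemLp (fun ω => A k • y k ω) 2 P := by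
    intro k
    induction k with
    | zero =>
      constructor
      · rw [show v 0 = fun _ => 0 from funext hv0]; exact memLp_const _
      · simp only [hA0, zero_smul]; exact memLp_const _
    | succ k ih =>
      have h1 := hxL' k ih.1 ih.2
      have h2 : MemLp (v (k + 1)) 2 P := by
        rw [show v (k + 1) = _ from funext (hvw k)]
        exact (hwL' k ih.1 h1).sub (hcs _ _ ((hgL _ h1).add (hξL (k + 1))))
      refine ⟨h2, ?_⟩
      rw [show (fun ω => A (k + 1) • y (k + 1) ω) = _ from funext (hyA k)]
      exact ih.2.add (hcs _ _ h2)
  have hxL : ∀ k, MemLp (x (k + 1)) 2 P := fun k => hxL' k (hvyL k).1 (hvyL k).2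
  have hwL : ∀ k, MemLp (w k) 2 P := fun k => hwL' k (hvyL k).1 (hxL k)
  -- measurability
  have hwm' : ∀ k, StronglyMeasurable[ℱ (k + 1)] (v k) →
      StronglyMeasurable[ℱ (k + 1)] (w k) := by
    intro k h1
    rw [show w k = _ from funext (hwd k)]
    exact hms _ _ _ ((hms _ _ _ h1).add (hms _ _ _ (hxadapt (k + 1))))
  have hvm : ∀ k, StronglyMeasurable[ℱ (k + 1)] (v k) := by
    intro k
    induction k with
    | zero => rw [show v 0 = fun _ => 0 from funext hv0]; exact stronglyMeasurable_const
    | succ k ih =>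
      have hle : ℱ (k + 1) ≤ ℱ (k + 1 + 1) := hℱmono (by omega)
      rw [show v (k + 1) = _ from funext (hvw k)]
      exact ((hwm' k ih).mono hle).sub
        (hms _ _ _ ((hgc.comp_stronglyMeasurable ((hxadapt (k + 1)).mono hle)).add
          (hξadapt (k + 1))))
  have hwm := fun k => hwm' k (hvm k)
  -- Lyapunov function
  have hsq : ∀ X : Ω → EuclideanSpace ℝ (Fin n), MemLp X 2 P →
      Integrable (fun ω => ‖X ω‖ ^ 2) P := fun X hX =>
    (memLp_two_iff_integrable_sq_norm hX.1).1 hX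
  have hdL : ∀ k, MemLp (fun ω => v k ω - ystar) 2 P := fun k =>
    (hvyL k).1.sub (memLp_const _)
  have hF2 : ∀ k, Integrable (fun ω => A k * (f (y k ω) - f ystar)) P := fun k =>
    ((hfyint k).sub (integrable_const _)).const_mul _
  have hF1 : ∀ k, Integrable (fun ω => (μ * A k + 1) / 2 * ‖v k ω - ystar‖ ^ 2) P := fun k =>
    (hsq _ (hdL k)).const_mul _
  have main : ∀ k, ∫ ω, ((μ * A k + 1) / 2 * ‖v k ω - ystar‖ ^ 2
      + A k * (f (y k ω) - f ystar)) ∂P ≤ 1 / 2 * ‖ystar‖ ^ 2 := by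
    intro k
    induction k with
    | zero => simp [hA0, hv0]
    | succ k ih =>
      refine le_trans ?_ ih
      have hG := hgL _ (hxL k)
      have hE := hξL (k + 1)
      have hU : MemLp (fun ω => ystar - w k ω) 2 P := (memLp_const _).sub (hwL k)
      have i1 : Integrable (fun ω => (μ * A k + 1) / 2 * ‖v k ω - ystar‖ ^ 2
          + A k * (f (y k ω) - f ystar)) P := (hF1 k).add (hF2 k)
      have i2 : Integrable (fun ω => α (k + 1) * ⟪ystar - w k ω, ξ (k + 1) ω⟫) P :=
        (hp_inner_int P hU hE).const_mul _
      have i3a : Integrable (fun ω => (1 + lam) * ‖ξ (k + 1) ω‖ ^ 2) P :=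
        (hsq _ hE).const_mul _
      have i3b : Integrable (fun ω => (1 - lam) * ‖g (x (k + 1) ω)‖ ^ 2) P :=
        (hsq _ hG).const_mul _
      have i3 : Integrable (fun ω => α (k + 1) ^ 2 / (2 * (μ * A (k + 1) + 1)) *
          ((1 + lam) * ‖ξ (k + 1) ω‖ ^ 2 - (1 - lam) * ‖g (x (k + 1) ω)‖ ^ 2)) P :=
        (i3a.sub i3b).const_mul _
      have i4 : Integrable (fun ω => α (k + 1) ^ 2 / (μ * A (k + 1) + 1) * lam *
          ⟪g (x (k + 1) ω), ξ (k + 1) ω⟫) P := (hp_inner_int P hG hE).const_mul _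
      have hpt : ∀ ω, (μ * A (k + 1) + 1) / 2 * ‖v (k + 1) ω - ystar‖ ^ 2
          + A (k + 1) * (f (y (k + 1) ω) - f ystar) ≤
          (μ * A k + 1) / 2 * ‖v k ω - ystar‖ ^ 2 + A k * (f (y k ω) - f ystar)
          + α (k + 1) * ⟪ystar - w k ω, ξ (k + 1) ω⟫
          + α (k + 1) ^ 2 / (2 * (μ * A (k + 1) + 1)) *
          ((1 + lam) * ‖ξ (k + 1) ω‖ ^ 2 - (1 - lam) * ‖g (x (k + 1) ω)‖ ^ 2)
          + α (k + 1) ^ 2 / (μ * A (k + 1) + 1) * lam *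
          ⟪g (x (k + 1) ω), ξ (k + 1) ω⟫ := by
        intro ω
        refine hp_step L μ lam (A k) (α (k + 1)) _ _ (A (k + 1)) (f (x (k + 1) ω)) _ _ _ hμ
          (hA k) (hαp k) rfl rfl (hAr k) (hstep (k + 1) (by omega)) (x (k + 1) ω) (y (k + 1) ω)
          (y k ω) _ _ _ _ _ _ (hwM k ω) (hvw k ω) ?_ ?_ (hsmooth _ _) ?_ (hsc _ _)
        · apply smul_right_injective _ (hA1 k).ne'
          simp only
          rw [smul_sub, hyA, hxw, smul_smul, mul_div_cancel₀ _ (hA1 k).ne']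
          module
        · have h := hxw k ω
          rw [hAr] at h
          have h' : A k • y k ω = (A k + α (k + 1)) • x (k + 1) ω - α (k + 1) • w k ω :=
            eq_sub_of_add_eq h.symm
          rw [smul_sub, h']; module
        · have := hsc (x (k + 1) ω) (y k ω)
          have h0 : 0 ≤ μ / 2 * ‖y k ω - x (k + 1) ω‖ ^ 2 := by positivity
          linarith
      have z1 : ∫ ω, ⟪ystar - w k ω, ξ (k + 1) ω⟫ ∂P = 0 :=
        hp_inner_zero (ℱ (k + 1)) P (hℱle _) hU hE
          (stronglyMeasurable_const.sub (hwm k)) (hcond0 _ (by omega))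
      have z2 : ∫ ω, ⟪g (x (k + 1) ω), ξ (k + 1) ω⟫ ∂P = 0 :=
        hp_inner_zero (ℱ (k + 1)) P (hℱle _) hG hE
          (hgc.comp_stronglyMeasurable (hxadapt (k + 1))) (hcond0 _ (by omega))
      have z3 : ∫ ω, ‖ξ (k + 1) ω‖ ^ 2 ∂P ≤
          (1 - lam) / (1 + lam) * ∫ ω, ‖g (x (k + 1) ω)‖ ^ 2 ∂P := by
        rw [← integral_condExp (hℱle (k + 1)), ← integral_const_mul]
        exact integral_mono_ae integrable_condExp ((hsq _ hG).const_mul _)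
          (hcondvar (k + 1) (by omega))
      have z4 : (1 + lam) * ∫ ω, ‖ξ (k + 1) ω‖ ^ 2 ∂P ≤
          (1 - lam) * ∫ ω, ‖g (x (k + 1) ω)‖ ^ 2 ∂P := by
        have h1 : 0 < 1 + lam := by linarith
        rw [div_mul_eq_mul_div, le_div_iff₀ h1] at z3
        linarith
      have hint := integral_mono ((hF1 (k + 1)).add (hF2 (k + 1)))
        (((i1.add i2).add i3).add i4) hpt
      refine hint.trans ?_
      rw [integral_add' ((i1.add i2).add i3) i4, integral_add' (i1.add i2) i3,
        integral_add' i1 i2, integral_const_mul, integral_const_mul, integral_const_mul, z1, z2,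
        integral_sub i3a i3b, integral_const_mul, integral_const_mul]
      have h5 : 0 ≤ α (k + 1) ^ 2 / (2 * (μ * A (k + 1) + 1)) := by
        have := hM (k + 1); positivity
      have := mul_nonneg h5 (sub_nonneg.2 z4)
      linarith
  intro k hk
  obtain ⟨j, rfl⟩ : ∃ j, k = j + 1 := ⟨k - 1, by omega⟩
  have h := main (j + 1)
  rw [integral_add (hF1 _) (hF2 _), integral_const_mul (A (j + 1)),
    integral_sub (hfyint _) (integrable_const _), integral_const] at h
  have h0 : 0 ≤ ∫ ω, (μ * A (j + 1) + 1) / 2 * ‖v (j + 1) ω - ystar‖ ^ 2 ∂P :=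
    integral_nonneg fun ω => by have := hM (j + 1); positivity
  rw [le_div_iff₀ (hA1 j)]
  simp only [probReal_univ, one_smul] at h
  linarith
end

section
/- (SAGA variance recursion.) Let f_1, …, f_m : C → ℝ on convex C ⊆ ℝⁿ each have (L/m)-Lipschitz continuous gradient, and let (x_k)_{k≥0} be a (possibly random) sequence in C. Define the SAGA memory by ψ_0^l = x_0 for all l; at each step k ≥ 1 draw J_k ⊆ {1,…,m} of size b uniformly at random, independently of the past given the history, set ψ_k^j = x_k for j ∈ J_k and ψ_k^l = ψ_{k-1}^l otherwise, and put ∇̃f(x_k) = (m/b) Σ_{j∈J_k} ∇f_j(x_k) − (m/b) Σ_{j∈J_k} ∇f_j(ψ_{k-1}^j) + Σ_{l=1}^m ∇f_l(ψ_{k-1}^l). Then ∇̃f(x_k) is conditionally unbiased, E[∇̃f(x_k) | history] = ∇f(x_k) where ∇f = Σ_l ∇f_l, and for every k ≥ 1: E[ ‖∇̃f(x_k) − ∇f(x_k)‖² ] ≤ (3m²/b²) Σ_{τ=1}^k (1 − b/(2m))^{k−τ} Σ_{l=1}^m E[ ‖∇f_l(x_τ) − ∇f_l(x_{τ−1})‖²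 ]. -/
open Finset MeasureTheory
open scoped ENNReal

lemma aux_set {Ω E : Type*} [NormedAddCommGroup E] [NormedSpace ℝ E] 
    {mΩ : MeasurableSpace Ω} (P : Measure Ω) [IsProbabilityMeasure P]
    (m0 : MeasurableSpace Ω) (hle : m0 ≤ mΩ) (A : Set Ω) (c : ℝ≥0∞)
    (h : ∀ t, MeasurableSet[m0] t → P (A ∩ t) = c * P t) (F : Ω → E)
    (hF : StronglyMeasurable[m0] F) : ∫ ω in A, F ω ∂P = c.toReal • ∫ ω, F ω ∂P := by
  rw [integral_trim hle hF, integral_trim (μ := P) hle hF, ← integral_smul_measure]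
  congr 1
  refine @Measure.ext _ m0 _ _ fun t ht => ?_
  rw [trim_measurableSet_eq hle ht, Measure.restrict_apply (hle t ht), Measure.smul_apply,
    trim_measurableSet_eq hle ht, Set.inter_comm, h t ht, smul_eq_mul]

lemma aux_int {Ω E : Type*} [NormedAddCommGroup E] [NormedSpace ℝ E] 
    {mΩ : MeasurableSpace Ω} (P : Measure Ω) [IsProbabilityMeasure P]
    (m0 : MeasurableSpace Ω) (hle : m0 ≤ mΩ) {m b : ℕ}
    (J : Ω → Finset (Fin m)) (hc : ∀ ω, (J ω).card = b)
    (hJm : ∀ s, MeasurableSet[mΩ] {ω | J ω = s})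
    (hu : ∀ s0 : Finset (Fin m), s0.card = b →
      ∀ t : Set Ω, MeasurableSet[m0] t →
        P ({ω | J ω = s0} ∩ t) =
          P t / ((Finset.powersetCard b (Finset.univ : Finset (Fin m))).card : ℝ≥0∞))
    (G : Finset (Fin m) → Ω → E) (hG : ∀ s, StronglyMeasurable[m0] (G s))
    (hi : ∀ s, Integrable (G s) P) :
    Integrable (fun ω => G (J ω) ω) P ∧ ∫ ω, G (J ω) ω ∂P =
      ((m.choose b : ℝ))⁻¹ • ∫ ω, ∑ s ∈ powersetCard b (univ : Finset (Fin m)), G s ω ∂P := by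
  have e : (fun ω => G (J ω) ω) = fun ω => ∑ s ∈ powersetCard b (univ : Finset (Fin m)),
      Set.indicator {ω | J ω = s} (G s) ω := by
    funext ω
    rw [Finset.sum_eq_single (J ω)]
    · simp
    · intro s _ hs
      simp [Set.indicator, Ne.symm hs]
    · intro h; exact absurd (mem_powersetCard.2 ⟨subset_univ _, hc ω⟩) h
  have hii : ∀ s ∈ powersetCard b (univ : Finset (Fin m)),
      Integrable (Set.indicator {ω | J ω = s} (G s)) P :=
    fun s _ => (hi s).indicator (hJm s)
  constructor
  · rw [e]; exact integrable_finsetSum _ hii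
  · rw [e, integral_finsetSum _ hii, integral_finsetSum _ (fun s _ => hi s), Finset.smul_sum]
    refine Finset.sum_congr rfl fun s hs => ?_
    rw [integral_indicator (hJm s), aux_set P m0 hle _ ((m.choose b : ℝ≥0∞)⁻¹) _ _ (hG s)]
    · simp
    · intro t ht
      rw [hu s (mem_powersetCard.1 hs).2 t ht, ENNReal.div_eq_inv_mul]
      simp

lemma cnt_const {m : ℕ} (b : ℕ) (T T' : Finset (Fin m)) (h : T.card = T'.card) :
    #{s ∈ powersetCard b (univ : Finset (Fin m)) | T ⊆ s} =
    #{s ∈ powersetCard b (univ : Finset (Fin m)) | T' ⊆ s} := by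
  have key : ∀ T : Finset (Fin m), #{s ∈ powersetCard b (univ : Finset (Fin m)) | T ⊆ s} =
     if T.card ≤ b then (m - T.card).choose (b - T.card) else 0 := by
    intro T
    split_ifs with hT
    · have : #Tᶜ = m - T.card := by simp [Finset.card_compl]
      rw [← this, ← card_powersetCard]
      refine Finset.card_bij' (fun s _ => s \ T) (fun s _ => s ∪ T) ?_ ?_ ?_ ?_
      · intro s hs
        simp only [mem_filter, mem_powersetCard] at hs ⊢
        refine ⟨fun x hx => by simp at hx ⊢; exact hx.2, ?_⟩
        rw [card_sdiff_of_subset hs.2, hs.1.2]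
      · intro s hs
        simp only [mem_filter, mem_powersetCard] at hs ⊢
        refine ⟨⟨subset_univ _, ?_⟩, subset_union_right⟩
        rw [card_union_of_disjoint, hs.2]; omega
        exact disjoint_left.2 fun x hx hx' => by simpa [hx'] using hs.1 hx
      · intro s hs
        simp only [mem_filter] at hs
        exact sdiff_union_of_subset hs.2
      · intro s hs
        simp only [mem_powersetCard] at hs
        ext x
        have := @hs.1 x
        simp at this ⊢
        tauto
    · rw [card_eq_zero, filter_eq_empty_iff]
      intro s hs h
      have := card_le_card h
      rw [(mem_powersetCard.1 hs).2] at this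
      exact hT this
  rw [key, key, h]

lemma cnt {m b : ℕ} (hm : 1 ≤ m) :
    ∃ c1 c2 : ℝ, 0 ≤ c2 ∧ c2 ≤ c1 ∧ m * c1 = m.choose b * b ∧ (c1 + (m - 1) * c2 = b * c1) ∧ 
    (∀ i : Fin m, (∑ s ∈ powersetCard b (univ : Finset (Fin m)), if i ∈ s then (1:ℝ) else 0) = c1) ∧
    (∀ i j : Fin m, i ≠ j → (∑ s ∈ powersetCard b (univ : Finset (Fin m)), if i ∈ s ∧ j ∈ s then (1:ℝ) else 0) = c2) := by
  have i0 : Fin m := ⟨0, hm⟩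
  set S := powersetCard b (univ : Finset (Fin m)) with hS
  have h1 : ∀ i, (∑ s ∈ S, if i ∈ s then (1:ℝ) else 0) = (∑ s ∈ S, if i0 ∈ s then (1:ℝ) else 0) := by
    intro i
    have := cnt_const b {i} {i0} rfl
    simp only [singleton_subset_iff] at this
    simp only [sum_boole]
    exact_mod_cast this
  have h2 : ∃ c2 : ℝ, ∀ i j : Fin m, i ≠ j → (∑ s ∈ S, if i ∈ s ∧ j ∈ s then (1:ℝ) else 0) = c2 := by
    by_cases h : ∃ i j : Fin m, i ≠ j
    · obtain ⟨i', j', hij'⟩ := h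
      refine ⟨(∑ s ∈ S, if i' ∈ s ∧ j' ∈ s then (1:ℝ) else 0), fun i j hij => ?_⟩
      have := cnt_const b {i, j} {i', j'} (by rw [card_pair hij, card_pair hij'])
      simp only [insert_subset_iff, singleton_subset_iff] at this
      simp only [sum_boole]
      exact_mod_cast this
    · push Not at h
      exact ⟨0, fun i j hij => absurd (h i j) hij⟩
  set c1 := (∑ s ∈ S, if i0 ∈ s then (1:ℝ) else 0) with hc1
  have e1 : (m:ℝ) * c1 = m.choose b * b := by
    have : ∑ i : Fin m, (∑ s ∈ S, if i ∈ s then (1:ℝ) else 0) = m * c1 := by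
      simp [h1]
    rw [← this, sum_comm]
    rw [sum_congr rfl (g := fun _ => (b:ℝ))]
    · simp [hS]
    · intro s hs
      simp [(mem_powersetCard.1 hs).2]
  obtain ⟨c2, h2⟩ := h2
  have e2 : c1 + (m - 1) * c2 = b * c1 := by
    have h3 : ∑ j : Fin m, (∑ s ∈ S, if i0 ∈ s ∧ j ∈ s then (1:ℝ) else 0) = b * c1 := by
      rw [sum_comm, hc1, mul_sum]
      refine sum_congr rfl fun s hs => ?_
      by_cases h : i0 ∈ s <;> simp [h, (mem_powersetCard.1 hs).2]
    rw [← h3, ← add_sum_erase _ _ (mem_univ i0)]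
    rw [sum_congr rfl (s₁ := univ.erase i0) (g := fun _ => c2)]
    · simp [hc1, Nat.cast_sub hm]
    · intro j hj
      exact h2 _ _ (ne_of_mem_erase hj).symm
  have hc1n : 0 ≤ c1 := sum_nonneg fun s _ => by split_ifs <;> norm_num
  rcases Nat.lt_or_ge 1 m with hm1 | hm1
  · obtain ⟨j0, hne⟩ : ∃ j0, i0 ≠ j0 := by
      have : Nontrivial (Fin m) := Fin.nontrivial_iff_two_le.2 hm1
      obtain ⟨j0, h⟩ := exists_ne i0
      exact ⟨j0, h.symm⟩
    have hh := h2 _ _ hne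
    refine ⟨c1, c2, ?_, ?_, e1, e2, h1, h2⟩
    · rw [← hh]; exact sum_nonneg fun s _ => by split_ifs <;> norm_num
    · rw [← hh]; refine sum_le_sum fun s _ => ?_
      by_cases h1 : i0 ∈ s <;> by_cases h2 : j0 ∈ s <;> simp [h1, h2]
  · have : m = 1 := by omega
    subst this
    refine ⟨c1, 0, le_rfl, hc1n, e1, by simpa using e2, h1, fun i j hij => absurd (Subsingleton.elim i j) hij⟩

lemma alg {E : Type*} [NormedAddCommGroup E] [InnerProductSpace ℝ E] {m b : ℕ} (hm : 1 ≤ m)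
    (hb : 1 ≤ b) (d : Fin m → E) :
    (∑ s ∈ powersetCard b (univ : Finset (Fin m)), (((m : ℝ) / b) • ∑ j ∈ s, d j - ∑ l, d l) = 0) ∧
    (∑ s ∈ powersetCard b (univ : Finset (Fin m)), ‖((m : ℝ) / b) • ∑ j ∈ s, d j - ∑ l, d l‖ ^ 2
      ≤ m.choose b * ((m / b) * ∑ l, ‖d l‖ ^ 2)) := by
  obtain ⟨c1, c2, hc2, h21, e1, e2, h1, h2⟩ := cnt (b := b) hm
  set S := powersetCard b (univ : Finset (Fin m)) with hS
  set D := ∑ l, d l with hD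
  have hm' : (0:ℝ) < m := by exact_mod_cast hm
  have hb' : (0:ℝ) < b := by exact_mod_cast hb
  have hs : ∀ s : Finset (Fin m), ∑ j ∈ s, d j = ∑ j, (if j ∈ s then (1:ℝ) else 0) • d j := by
    intro s
    simp [Finset.sum_ite_mem]
  have A : ∑ s ∈ S, ∑ j ∈ s, d j = c1 • D := by
    simp_rw [hs]
    rw [sum_comm]
    simp_rw [← sum_smul, h1, ← smul_sum]
    rfl
  have hN : (m:ℝ) / b * c1 = m.choose b := by
    field_simp; linarith
  have A' : ∑ s ∈ S, ((m : ℝ) / b) • ∑ j ∈ s, d j = (m.choose b : ℝ) • D := by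
    rw [← smul_sum, A, smul_smul, hN]
  have B : ∑ s ∈ S, ‖∑ j ∈ s, d j‖ ^ 2 = c2 * ‖D‖ ^ 2 + (c1 - c2) * ∑ l, ‖d l‖ ^ 2 := by
    have : ∀ s ∈ S, ‖∑ j ∈ s, d j‖ ^ 2 =
        ∑ i, ∑ j, (if i ∈ s ∧ j ∈ s then (1:ℝ) else 0) * inner ℝ (d i) (d j) := by
      intro s _
      rw [← real_inner_self_eq_norm_sq, hs, sum_inner]
      refine sum_congr rfl fun i _ => ?_
      rw [inner_sum]
      refine sum_congr rfl fun j _ => ?_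
      rw [inner_smul_left, inner_smul_right]
      by_cases h1 : i ∈ s <;> by_cases h2 : j ∈ s <;> simp [h1, h2]
    rw [sum_congr rfl this, sum_comm]
    have h3 : ∀ i, ∑ s ∈ S, ∑ j, (if i ∈ s ∧ j ∈ s then (1:ℝ) else 0) * inner ℝ (d i) (d j) =
        c2 * inner ℝ (d i) D + (c1 - c2) * ‖d i‖ ^ 2 := by
      intro i
      rw [sum_comm]
      simp_rw [← sum_mul]
      rw [hD, inner_sum, ← add_sum_erase _ _ (mem_univ i), ← add_sum_erase univ (fun j => inner ℝ (d i) (d j)) (mem_univ i)]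
      rw [sum_congr rfl (s₁ := univ.erase i) (g := fun j => c2 * inner ℝ (d i) (d j))]
      · simp only [and_self]
        rw [h1, ← mul_sum, real_inner_self_eq_norm_sq]
        ring
      · intro j hj
        rw [h2 _ _ (ne_of_mem_erase hj).symm]
    rw [sum_congr rfl fun i _ => h3 i, sum_add_distrib, ← mul_sum, ← mul_sum, ← sum_inner,
      real_inner_self_eq_norm_sq]
  constructor
  · rw [sum_sub_distrib, A']
    simp [hS, ← Nat.cast_smul_eq_nsmul ℝ]
  · have e : ∑ s ∈ S, ‖((m : ℝ) / b) • ∑ j ∈ s, d j - D‖ ^ 2 =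
        ((m:ℝ) / b) ^ 2 * ∑ s ∈ S, ‖∑ j ∈ s, d j‖ ^ 2 - m.choose b * ‖D‖ ^ 2 := by
      simp_rw [norm_sub_sq_real]
      rw [sum_add_distrib, sum_sub_distrib, ← mul_sum, ← sum_inner, A', inner_smul_left,
        real_inner_self_eq_norm_sq]
      simp_rw [norm_smul, mul_pow]
      rw [← mul_sum]
      simp [hS]
      ring
    rw [e, B]
    have q : (0:ℝ) ≤ (m:ℝ)/b := by positivity
    have k1 : ((m:ℝ) / b) ^ 2 * c2 ≤ m.choose b := by
      rw [← hN, sq, mul_assoc]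
      refine mul_le_mul_of_nonneg_left ?_ q
      rw [div_mul_eq_mul_div, div_le_iff₀ hb']
      nlinarith
    have k2 : ((m:ℝ) / b) ^ 2 * (c1 - c2) ≤ m.choose b * (m / b) := by
      rw [← hN]
      nlinarith [mul_nonneg (mul_nonneg q q) hc2]
    have n1 : 0 ≤ ‖D‖ ^ 2 := by positivity
    have n2 : 0 ≤ ∑ l, ‖d l‖ ^ 2 := sum_nonneg fun _ _ => by positivity
    nlinarith [mul_le_mul_of_nonneg_right k1 n1, mul_le_mul_of_nonneg_right k2 n2]

lemma cnt_not {m b : ℕ} (hm : 1 ≤ m) (l : Fin m) :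
    (∑ s ∈ powersetCard b (univ : Finset (Fin m)), if l ∈ s then (0:ℝ) else 1) =
      m.choose b * (1 - b / m) := by
  obtain ⟨c1, c2, hc2, h21, e1, e2, h1, h2⟩ := cnt (b := b) hm
  have hm' : (0:ℝ) < m := by exact_mod_cast hm
  have : ∀ s : Finset (Fin m), (if l ∈ s then (0:ℝ) else 1) = 1 - if l ∈ s then (1:ℝ) else 0 := by
    intro s; split_ifs <;> norm_num
  simp_rw [this]
  rw [sum_sub_distrib, h1]
  simp
  field_simp
  linarith

/-- SAGA variance recursion: the SAGA gradient estimate is conditionally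
unbiased and its variance satisfies
`E‖∇̃f(x_k) - ∇f(x_k)‖² ≤ (3m²/b²) Σ_{τ=1}^k (1 - b/(2m))^{k-τ} Σ_l E‖∇f_l(x_τ) - ∇f_l(x_{τ-1})‖²`. -/
theorem stmt_18 {n : ℕ} (C : Set (EuclideanSpace ℝ (Fin n))) (hC : Convex ℝ C)
    (m b : ℕ) (hm : 1 ≤ m) (hb1 : 1 ≤ b) (hbm : b ≤ m) (L : ℝ) (hL : 0 < L)
    (fl : Fin m → EuclideanSpace ℝ (Fin n) → ℝ)
    (gl : Fin m → EuclideanSpace ℝ (Fin n) → EuclideanSpace ℝ (Fin n))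
    (hgradl : ∀ l, ∀ u ∈ C, HasGradientWithinAt (fl l) (gl l u) C u)
    (hlipl : ∀ l, ∀ u ∈ C, ∀ w ∈ C, ‖gl l u - gl l w‖ ≤ L / m * ‖u - w‖)
    -- probability space, filtration, and the random iterates
    {Ω : Type*} [MeasurableSpace Ω] (P : Measure Ω) [IsProbabilityMeasure P]
    (ℱ : ℕ → MeasurableSpace Ω) (hℱle : ∀ k, ℱ k ≤ ‹MeasurableSpace Ω›)
    (hℱmono : Monotone ℱ)
    (x : ℕ → Ω → EuclideanSpace ℝ (Fin n))
    (hxC : ∀ k ω, x k ω ∈ C)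
    (hxadapt : ∀ k, StronglyMeasurable[ℱ k] (x k))
    -- the random index sets: uniform over size-b subsets, independent of the past
    (J : ℕ → Ω → Finset (Fin m))
    (hJcard : ∀ k, 1 ≤ k → ∀ ω, (J k ω).card = b)
    (hJmeas : ∀ k, 1 ≤ k → ∀ s0 : Finset (Fin m), MeasurableSet[ℱ (k + 1)] {ω | J k ω = s0})
    (hJuniform : ∀ k, 1 ≤ k → ∀ s0 : Finset (Fin m), s0.card = b →
      ∀ t : Set Ω, MeasurableSet[ℱ k] t →
        P ({ω | J k ω = s0} ∩ t) =
          P t / ((Finset.powersetCard b (Finset.univ : Finset (Fin m))).card : ℝ≥0∞))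
    -- the SAGA memory and gradient estimate
    (ψ : ℕ → Fin m → Ω → EuclideanSpace ℝ (Fin n))
    (hψ0 : ∀ l ω, ψ 0 l ω = x 0 ω)
    (hψrec : ∀ k, 1 ≤ k → ∀ l ω,
      ψ k l ω = if l ∈ J k ω then x k ω else ψ (k - 1) l ω)
    (tg : ℕ → Ω → EuclideanSpace ℝ (Fin n))
    (htg : ∀ k, 1 ≤ k → ∀ ω, tg k ω =
      ((m : ℝ) / b) • (∑ j ∈ J k ω, gl j (x k ω))
        - ((m : ℝ) / b) • (∑ j ∈ J k ω, gl j (ψ (k - 1) j ω))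
        + ∑ l, gl l (ψ (k - 1) l ω))
    -- integrability
    (htgint : ∀ k, Integrable (tg k) P)
    (hgint : ∀ k, Integrable (fun ω => ∑ l, gl l (x k ω)) P)
    (hvarint : ∀ k, Integrable (fun ω => ‖tg k ω - ∑ l, gl l (x k ω)‖ ^ 2) P)
    (hdiffint : ∀ k, 1 ≤ k → ∀ l,
      Integrable (fun ω => ‖gl l (x k ω) - gl l (x (k - 1) ω)‖ ^ 2) P) :
    ∀ k, 1 ≤ k →
      (P[tg k|ℱ k] =ᵐ[P] fun ω => ∑ l, gl l (x k ω)) ∧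
      (∫ ω, ‖tg k ω - ∑ l, gl l (x k ω)‖ ^ 2 ∂P) ≤
        3 * m ^ 2 / b ^ 2 * ∑ τ ∈ Icc 1 k, (1 - (b : ℝ) / (2 * m)) ^ (k - τ) *
          ∑ l, ∫ ω, ‖gl l (x τ ω) - gl l (x (τ - 1) ω)‖ ^ 2 ∂P := by
  classical
  have hm' : (0:ℝ) < m := by exact_mod_cast hm
  have hb' : (0:ℝ) < b := by exact_mod_cast hb1
  have hbm' : (b:ℝ) ≤ m := by exact_mod_cast hbm
  have hN : (0:ℝ) < m.choose b := by exact_mod_cast Nat.choose_pos hbm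
  have hcomp : ∀ (l : Fin m) (m0 : MeasurableSpace Ω) (y : Ω → EuclideanSpace ℝ (Fin n)),
      (∀ ω, y ω ∈ C) → StronglyMeasurable[m0] y → StronglyMeasurable[m0] (fun ω => gl l (y ω)) := by
    intro l m0 y hy hym
    have hc : Continuous (C.domRestrict (gl l)) := by
      rw [← continuousOn_iff_continuous_domRestrict]
      have : LipschitzOnWith (Real.toNNReal (L / m)) (gl l) C := by
        refine LipschitzOnWith.of_dist_le_mul fun u hu w hw => ?_
        rw [dist_eq_norm, dist_eq_norm, Real.coe_toNNReal _ (by positivity)]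
        exact hlipl l u hu w hw
      exact this.continuousOn
    have h1 : Measurable[m0] (fun ω => (⟨y ω, hy ω⟩ : C)) := hym.measurable.subtype_mk
    exact (hc.measurable.comp h1).stronglyMeasurable
  have hJl : ∀ k, 1 ≤ k → ∀ l, MeasurableSet[ℱ (k+1)] {ω | l ∈ J k ω} := by
    intro k hk l
    have : {ω | l ∈ J k ω} = ⋃ s ∈ {s : Finset (Fin m) | l ∈ s}, {ω | J k ω = s} := by
      ext ω; simp
    rw [this]
    exact MeasurableSet.biUnion (Set.to_countable _) fun s _ => hJmeas k hk s
  have hψC : ∀ k l ω, ψ k l ω ∈ C := by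
    intro k l ω
    induction k with
    | zero => rw [hψ0]; exact hxC _ _
    | succ k ih =>
      rw [hψrec (k+1) (by omega)]
      split_ifs
      · exact hxC _ _
      · exact ih
  have hψm : ∀ k l, StronglyMeasurable[ℱ (k+1)] (ψ k l) := by
    intro k l
    induction k with
    | zero =>
      have : ψ 0 l = x 0 := funext fun ω => hψ0 l ω
      rw [this]; exact (hxadapt 0).mono (hℱmono (by omega))
    | succ k ih =>
      have : ψ (k+1) l = fun ω => if l ∈ J (k+1) ω then x (k+1) ω else ψ k l ω :=
        funext fun ω => hψrec (k+1) (by omega) l ω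
      rw [this]
      exact StronglyMeasurable.ite (hJl (k+1) (by omega) l)
        ((hxadapt (k+1)).mono (hℱmono (by omega))) (ih.mono (hℱmono (by omega)))
  set d : ℕ → Fin m → Ω → EuclideanSpace ℝ (Fin n) :=
    fun k l ω => gl l (x k ω) - gl l (ψ (k-1) l ω) with hd
  set δ : ℕ → Fin m → Ω → EuclideanSpace ℝ (Fin n) :=
    fun k l ω => gl l (x k ω) - gl l (x (k-1) ω) with hδ
  have hdm : ∀ k, 1 ≤ k → ∀ l, StronglyMeasurable[ℱ k] (d k l) := by
    intro k hk l
    obtain ⟨k, rfl⟩ : ∃ j, k = j + 1 := ⟨k - 1, by omega⟩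
    exact (hcomp l _ _ (hxC _) (hxadapt _)).sub (hcomp l _ _ (hψC _ l) (hψm k l))
  have hδm : ∀ k, ∀ l, StronglyMeasurable[ℱ k] (δ k l) := by
    intro k l
    exact (hcomp l _ _ (hxC _) (hxadapt _)).sub
      (hcomp l _ _ (hxC _) ((hxadapt _).mono (hℱmono (by omega))))
  have hrec : ∀ k, 1 ≤ k → ∀ l ω,
      d (k+1) l ω = δ (k+1) l ω + if l ∈ J k ω then 0 else d k l ω := by
    intro k hk l ω
    simp only [hd, hδ, Nat.add_sub_cancel]
    rw [hψrec k hk]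
    split_ifs <;> simp
  have h1 : ∀ l ω, d 1 l ω = δ 1 l ω := by
    intro l ω; simp [hd, hδ, hψ0]
  set α : ℝ := b / (2 * m) with hα
  have hα0 : 0 < α := by positivity
  have hα1 : α ≤ 1 := by rw [hα, div_le_one (by positivity)]; linarith
  have young : ∀ u v : EuclideanSpace ℝ (Fin n),
      ‖u + v‖ ^ 2 ≤ (1 + α⁻¹) * ‖u‖ ^ 2 + (1 + α) * ‖v‖ ^ 2 := by
    intro u v
    have h2 : ‖u + v‖ ^ 2 ≤ (‖u‖ + ‖v‖) ^ 2 := by gcongr; exact norm_add_le _ _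
    have h3 : 0 ≤ α⁻¹ * (‖u‖ - α * ‖v‖) ^ 2 := by positivity
    have h4 : α⁻¹ * (‖u‖ - α * ‖v‖) ^ 2 = α⁻¹ * ‖u‖ ^ 2 - 2 * ‖u‖ * ‖v‖ + α * ‖v‖ ^ 2 := by
      field_simp
      ring
    nlinarith
  have hdrop : ∀ k, 1 ≤ k → ∀ l, Integrable (fun ω => ‖d k l ω‖ ^ 2) P →
      Integrable (fun ω => ‖if l ∈ J k ω then 0 else d k l ω‖ ^ 2) P ∧
      ∫ ω, ‖if l ∈ J k ω then 0 else d k l ω‖ ^ 2 ∂P = (1 - b / m) * ∫ ω, ‖d k l ω‖ ^ 2 ∂P := by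
    intro k hk l hi
    have := aux_int P (ℱ k) (hℱle k) (J k) (hJcard k hk) (fun s => hℱle _ _ (hJmeas k hk s))
      (hJuniform k hk) (fun s ω => (if l ∈ s then (0:ℝ) else 1) * ‖d k l ω‖ ^ 2)
      (fun s => stronglyMeasurable_const.mul ((hdm k hk l).norm.pow 2)) (fun s => hi.const_mul _)
    have e : (fun ω => ‖if l ∈ J k ω then 0 else d k l ω‖ ^ 2) =
        fun ω => (if l ∈ J k ω then (0:ℝ) else 1) * ‖d k l ω‖ ^ 2 := by
      funext ω; split_ifs <;> simp
    rw [e]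
    refine ⟨this.1, ?_⟩
    rw [this.2]
    simp_rw [← sum_mul]
    rw [cnt_not hm, integral_const_mul, smul_eq_mul]
    field_simp
  have hdi : ∀ k, 1 ≤ k → ∀ l, Integrable (fun ω => ‖d k l ω‖ ^ 2) P := by
    intro k hk l
    induction k, hk using Nat.le_induction with
    | base =>
      simp_rw [h1]
      exact hdiffint 1 le_rfl l
    | succ k hk ih =>
      refine Integrable.mono' (((hdiffint (k+1) (by omega) l).const_mul (1 + α⁻¹)).add
        (((hdrop k hk l ih).1).const_mul (1 + α))) ?_ (ae_of_all _ fun ω => ?_)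
      · exact (((hdm (k+1) (by omega) l).mono (hℱle _)).norm.pow 2).aestronglyMeasurable
      · rw [Real.norm_of_nonneg (by positivity), hrec k hk]
        exact young _ _
  have hdi1 : ∀ k, 1 ≤ k → ∀ l, Integrable (d k l) P := by
    intro k hk l
    have hms := ((hdm k hk l).mono (hℱle _)).aestronglyMeasurable (μ := P)
    exact ((memLp_two_iff_integrable_sq_norm hms).2 (hdi k hk l)).integrable (by norm_num)
  have hΔ : ∀ k l, 0 ≤ ∫ ω, ‖δ k l ω‖ ^ 2 ∂P := fun k l => integral_nonneg fun ω => by positivity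
  have hD0 : ∀ k l, 0 ≤ ∫ ω, ‖d k l ω‖ ^ 2 ∂P := fun k l => integral_nonneg fun ω => by positivity
  have hstep : ∀ k, 1 ≤ k → ∀ l, ∫ ω, ‖d (k+1) l ω‖ ^ 2 ∂P ≤
      3 * m / b * ∫ ω, ‖δ (k+1) l ω‖ ^ 2 ∂P + (1 - α) * ∫ ω, ‖d k l ω‖ ^ 2 ∂P := by
    intro k hk l
    have hA := (hdiffint (k+1) (by omega) l).const_mul (1 + α⁻¹)
    obtain ⟨hB1, hB2⟩ := hdrop k hk l (hdi k hk l)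
    have hB := hB1.const_mul (1 + α)
    have h2 : ∫ ω, ‖d (k+1) l ω‖ ^ 2 ∂P ≤ ∫ ω, ((1 + α⁻¹) * ‖δ (k+1) l ω‖ ^ 2 +
        (1 + α) * ‖if l ∈ J k ω then 0 else d k l ω‖ ^ 2) ∂P := by
      refine integral_mono (hdi (k+1) (by omega) l) (hA.add hB) fun ω => ?_
      simp only [hrec k hk]
      exact young _ _
    rw [integral_add hA hB, integral_const_mul, integral_const_mul, hB2] at h2
    refine h2.trans (add_le_add ?_ ?_)
    · refine mul_le_mul_of_nonneg_right ?_ (hΔ _ _)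
      rw [hα]
      field_simp
      linarith
    · rw [← mul_assoc]
      refine mul_le_mul_of_nonneg_right ?_ (hD0 _ _)
      have : (b:ℝ) / m = 2 * α := by rw [hα]; field_simp
      rw [this]
      nlinarith
  have hS : ∀ k, 1 ≤ k → ∑ l, ∫ ω, ‖d k l ω‖ ^ 2 ∂P ≤
      3 * m / b * ∑ τ ∈ Icc 1 k, (1 - α) ^ (k - τ) * ∑ l, ∫ ω, ‖δ τ l ω‖ ^ 2 ∂P := by
    intro k hk
    induction k, hk using Nat.le_induction with
    | base =>
      simp_rw [h1]
      simp only [Icc_self, sum_singleton, Nat.sub_self, pow_zero, one_mul]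
      refine le_mul_of_one_le_left (sum_nonneg fun l _ => hΔ _ _) ?_
      rw [le_div_iff₀ hb']; linarith
    | succ k hk ih =>
      rw [Finset.sum_Icc_succ_top (by omega : 1 ≤ k + 1)]
      have h2 : ∑ τ ∈ Icc 1 k, (1 - α) ^ (k + 1 - τ) * ∑ l, ∫ ω, ‖δ τ l ω‖ ^ 2 ∂P =
          (1 - α) * ∑ τ ∈ Icc 1 k, (1 - α) ^ (k - τ) * ∑ l, ∫ ω, ‖δ τ l ω‖ ^ 2 ∂P := by
        rw [mul_sum]
        refine sum_congr rfl fun τ hτ => ?_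
        rw [mem_Icc] at hτ
        rw [Nat.sub_add_comm hτ.2, pow_succ]
        ring
      rw [h2]
      refine (sum_le_sum fun l _ => hstep k hk l).trans ?_
      rw [sum_add_distrib, ← mul_sum, ← mul_sum]
      have h3 := mul_le_mul_of_nonneg_left ih (sub_nonneg.2 hα1)
      simp only [Nat.sub_self, pow_zero, one_mul]
      linarith
  intro k hk
  set V : Finset (Fin m) → Ω → EuclideanSpace ℝ (Fin n) :=
    fun s ω => ((m : ℝ) / b) • ∑ j ∈ s, d k j ω - ∑ l, d k l ω with hV
  have htV : ∀ ω, tg k ω - ∑ l, gl l (x k ω) = V (J k ω) ω := by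
    intro ω
    rw [htg k hk]
    simp only [hV, hd, sum_sub_distrib, smul_sub]
    abel
  have hVm : ∀ s, StronglyMeasurable[ℱ k] (V s) := by
    intro s
    exact ((Finset.stronglyMeasurable_fun_sum s fun j _ => hdm k hk j).const_smul ((m : ℝ) / b)).sub
      (Finset.stronglyMeasurable_fun_sum univ fun j _ => hdm k hk j)
  have hVi : ∀ s, Integrable (V s) P := by
    intro s
    exact ((integrable_finsetSum s fun j _ => hdi1 k hk j).smul ((m:ℝ)/b)).sub
      (integrable_finsetSum univ fun j _ => hdi1 k hk j)
  have hV2 : ∀ s, Integrable (fun ω => ‖V s ω‖ ^ 2) P := by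
    intro s
    have h2 : ∀ j, MemLp (d k j) 2 P := fun j =>
      (memLp_two_iff_integrable_sq_norm
        ((hdm k hk j).mono (hℱle _)).aestronglyMeasurable).2 (hdi k hk j)
    have : MemLp (V s) 2 P :=
      ((memLp_finsetSum s fun j _ => h2 j).const_smul ((m:ℝ)/b)).sub
      (memLp_finsetSum univ fun j _ => h2 j)
    exact (memLp_two_iff_integrable_sq_norm this.1).1 this
  have hgm : StronglyMeasurable[ℱ k] (fun ω => ∑ l, gl l (x k ω)) :=
    Finset.stronglyMeasurable_fun_sum univ fun l _ => hcomp l _ _ (hxC _) (hxadapt _)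
  constructor
  · symm
    refine ae_eq_condExp_of_forall_setIntegral_eq (hℱle k) (htgint k)
      (fun _ _ _ => (hgint k).integrableOn) ?_ hgm.aestronglyMeasurable
    intro t ht _
    symm
    rw [← sub_eq_zero, ← integral_sub (htgint k).integrableOn (hgint k).integrableOn,
      ← integral_indicator (hℱle k t ht)]
    have := aux_int P (ℱ k) (hℱle k) (J k) (hJcard k hk) (fun s => hℱle _ _ (hJmeas k hk s))
      (hJuniform k hk) (fun s => t.indicator (V s))
      (fun s => (hVm s).indicator ht) (fun s => (hVi s).indicator (hℱle k t ht))
    have e : (t.indicator fun ω => tg k ω - ∑ l, gl l (x k ω)) =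
        fun ω => t.indicator (V (J k ω)) ω := by
      funext ω
      simp only [Set.indicator, htV]
    rw [e, this.2]
    have z : ∀ ω, ∑ s ∈ powersetCard b (univ : Finset (Fin m)), t.indicator (V s) ω = 0 := by
      intro ω
      by_cases h : ω ∈ t
      · simp only [Set.indicator_of_mem h]
        exact (alg hm hb1 fun l => d k l ω).1
      · simp [Set.indicator_of_notMem h]
    simp [z]
  · simp_rw [htV]
    have := aux_int P (ℱ k) (hℱle k) (J k) (hJcard k hk) (fun s => hℱle _ _ (hJmeas k hk s))
      (hJuniform k hk) (fun s ω => ‖V s ω‖ ^ 2)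
      (fun s => (hVm s).norm.pow 2) hV2
    rw [this.2, smul_eq_mul]
    have h2 : ∫ ω, ∑ s ∈ powersetCard b (univ : Finset (Fin m)), ‖V s ω‖ ^ 2 ∂P ≤
        ∫ ω, m.choose b * ((m / b) * ∑ l, ‖d k l ω‖ ^ 2) ∂P := by
      refine integral_mono (integrable_finsetSum _ fun s _ => hV2 s)
        (((integrable_finsetSum _ fun l _ => hdi k hk l).const_mul _).const_mul _) fun ω => ?_
      exact (alg hm hb1 fun l => d k l ω).2
    rw [integral_const_mul, integral_const_mul, integral_finsetSum _ fun l _ => hdi k hk l] at h2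
    have h3 := mul_le_mul_of_nonneg_left h2 (inv_nonneg.2 hN.le)
    rw [inv_mul_cancel_left₀ hN.ne'] at h3
    refine h3.trans ((mul_le_mul_of_nonneg_left (hS k hk) (by positivity)).trans (le_of_eq ?_))
    rw [← mul_assoc]
    congr 1
    field_simp
end
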